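/- Let (P,Q,R,S) be a cycle of Lagrangians in a 2n-dimensional real symplectic vector space (V,ω), i.e. ⟨P,Q,R⟩, ⟨P,Q,S⟩, ⟨P,R,S⟩ and ⟨Q,R,S⟩ all hold. Then the positive halfspaces of (P,Q) and of (R,S) are disjoint: there is no nonzero v ∈ V with both B_{P,Q}(v,v) > 0 and B_{R,S}(v,v) > 0 (indeed B_{P,Q}(v,v) > 0 implies B_{R,S}(v,v) < 0). -/

import Mathlib

open Module

/-- A Lagrangian subspace: an `n`-dimensional subspace on which `ω` vanishes identically. -/
def IsLagrangian {V : Type*} [AddCommGroup V] [Module ℝ V]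
    (ω : LinearMap.BilinForm ℝ V) (n : ℕ) (L : Submodule ℝ V) : Prop :=
  finrank ℝ L = n ∧ ∀ v ∈ L, ∀ w ∈ L, ω v w = 0

/-- The relation `⟨X,Y,Z⟩` on Lagrangians: `X` and `Z` are transverse and
`B_{X,Z}(y,y) > 0` for all nonzero `y ∈ Y`. -/
def MaslovMax {V : Type*} [AddCommGroup V] [Module ℝ V]
    (ω : LinearMap.BilinForm ℝ V) (X Y Z : Submodule ℝ V) : Prop :=
  X ⊓ Z = ⊥ ∧ ∃ Inv : V →ₗ[ℝ] V, (∀ v ∈ X, Inv v = -v) ∧ (∀ v ∈ Z, Inv v = v) ∧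
    ∀ y ∈ Y, y ≠ 0 → 0 < ω y (Inv y)

/-- Two transverse Lagrangians span the whole space. -/
theorem IsLagrangian.exists_add_eq {V : Type*} [AddCommGroup V] [Module ℝ V]
    [FiniteDimensional ℝ V] {n : ℕ} (hdim : finrank ℝ V = 2 * n)
    {ω : LinearMap.BilinForm ℝ V} {X Z : Submodule ℝ V}
    (hX : IsLagrangian ω n X) (hZ : IsLagrangian ω n Z) (hXZ : X ⊓ Z = ⊥) (v : V) :
    ∃ x ∈ X, ∃ z ∈ Z, x + z = v := by
  have htop : X ⊔ Z = ⊤ := by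
    apply Submodule.eq_top_of_finrank_eq
    have h := Submodule.finrank_sup_add_finrank_inf_eq X Z
    rw [hXZ, finrank_bot, hX.1, hZ.1] at h
    omega
  exact Submodule.mem_sup.mp (htop ▸ Submodule.mem_top)

/-- The quadratic form of the reflection in `X, Z` takes the value `2 ω(x, z)` at `x + z`. -/
theorem IsLagrangian.apply_reflection_add {V : Type*} [AddCommGroup V] [Module ℝ V] {n : ℕ}
    {ω : LinearMap.BilinForm ℝ V} (halt : ω.IsAlt) {X Z : Submodule ℝ V}
    (hX : IsLagrangian ω n X) (hZ : IsLagrangian ω n Z) {Inv : V →ₗ[ℝ] V}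
    (h₁ : ∀ v ∈ X, Inv v = -v) (h₂ : ∀ v ∈ Z, Inv v = v) {x z : V} (hx : x ∈ X) (hz : z ∈ Z) :
    ω (x + z) (Inv (x + z)) = 2 * ω x z := by
  have hxx := hX.2 x hx x hx
  have hzz := hZ.2 z hz z hz
  have hneg := halt.neg_eq x z
  simp only [map_add, h₁ x hx, h₂ z hz, LinearMap.add_apply, map_neg]
  linarith

/-- If `⟨X,Y,Z⟩` holds and `x + z ∈ Y` with `x ∈ X` and `z ∈ Z`, then `ω(x, z) ≥ 0`. -/
theorem MaslovMax.apply_nonneg {V : Type*} [AddCommGroup V] [Module ℝ V] {n : ℕ}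
    {ω : LinearMap.BilinForm ℝ V} (halt : ω.IsAlt) {X Y Z : Submodule ℝ V}
    (hX : IsLagrangian ω n X) (hZ : IsLagrangian ω n Z) (h : MaslovMax ω X Y Z)
    {x z : V} (hx : x ∈ X) (hz : z ∈ Z) (hy : x + z ∈ Y) : 0 ≤ ω x z := by
  obtain ⟨-, Inv, h₁, h₂, hpos⟩ := h
  have hval := hX.apply_reflection_add halt hZ h₁ h₂ hx hz
  by_cases h0 : x + z = 0
  · rw [h0, map_zero, LinearMap.zero_apply] at hval
    linarith
  · linarith [hpos _ hy h0]

/-- if `(P,Q,R,S)` is a cycle of Lagrangians, the positive halfspaces of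
`(P,Q)` and `(R,S)` are disjoint: no nonzero `v` satisfies both `B_{P,Q}(v,v) > 0` and
`B_{R,S}(v,v) > 0`; indeed `B_{P,Q}(v,v) > 0` implies `B_{R,S}(v,v) < 0`. -/
theorem halfspaces_disjoint {V : Type*} [AddCommGroup V] [Module ℝ V]
    [FiniteDimensional ℝ V]
    (n : ℕ) (hn : 1 ≤ n) (hdim : finrank ℝ V = 2 * n)
    (ω : LinearMap.BilinForm ℝ V)
    (halt : ∀ v : V, ω v v = 0)
    (hnd : ∀ v : V, (∀ w : V, ω v w = 0) → v = 0)
    (P Q R S : Submodule ℝ V)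
    (hP : IsLagrangian ω n P) (hQ : IsLagrangian ω n Q)
    (hR : IsLagrangian ω n R) (hS : IsLagrangian ω n S)
    (hPQR : MaslovMax ω P Q R) (hPQS : MaslovMax ω P Q S)
    (hPRS : MaslovMax ω P R S) (hQRS : MaslovMax ω Q R S)
    (hPQ : P ⊓ Q = ⊥)
    (InvPQ : V →ₗ[ℝ] V)
    (hInvPQ₁ : ∀ v ∈ P, InvPQ v = -v) (hInvPQ₂ : ∀ v ∈ Q, InvPQ v = v)
    (hRS : R ⊓ S = ⊥)
    (InvRS : V →ₗ[ℝ] V)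
    (hInvRS₁ : ∀ v ∈ R, InvRS v = -v) (hInvRS₂ : ∀ v ∈ S, InvRS v = v) :
    (¬ ∃ v : V, v ≠ 0 ∧ 0 < ω v (InvPQ v) ∧ 0 < ω v (InvRS v)) ∧
    (∀ v : V, v ≠ 0 → 0 < ω v (InvPQ v) → ω v (InvRS v) < 0) := by
  have hω : ω.IsAlt := halt
  have hneg : ∀ v : V, v ≠ 0 → 0 < ω v (InvPQ v) → ω v (InvRS v) < 0 := by
    intro v _ hv
    obtain ⟨p, hp, q, hq, rfl⟩ := hP.exists_add_eq hdim hQ hPQ v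
    obtain ⟨r, hr, s, hs, hrs⟩ := hR.exists_add_eq hdim hS hRS (p + q)
    obtain ⟨a, ha, b, hb, rfl⟩ := hP.exists_add_eq hdim hR hPQR.1 q
    rw [hP.apply_reflection_add hω hQ hInvPQ₁ hInvPQ₂ hp hq, map_add, hP.2 p hp a ha] at hv
    rw [← hrs, hR.apply_reflection_add hω hS hInvRS₁ hInvRS₂ hr hs]
    have hab : 0 ≤ ω a b := hPQR.apply_nonneg hω hP hR ha hb hq
    have hs_eq : s = (p + a) + (b - r) := by
      rw [← sub_eq_zero, ← sub_eq_zero.mpr hrs]; abel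
    have hmem : (p + a) + -s ∈ R := by
      rw [show (p + a) + -s = r - b by rw [hs_eq]; abel]
      exact R.sub_mem hr hb
    have hPS := hPRS.apply_nonneg hω hP hS (P.add_mem hp ha) (S.neg_mem hs) hmem
    have hpa := hP.2 _ (P.add_mem hp ha) _ (P.add_mem hp ha)
    have hrb := hR.2 r hr _ (R.sub_mem hb hr)
    have hswap := hω.neg_eq r (p + a)
    rw [hs_eq] at hPS ⊢
    simp only [map_add, map_neg, map_sub, LinearMap.add_apply] at *
    linarith
  exact ⟨fun ⟨v, h0, h₁, h₂⟩ => lt_asymm h₂ (hneg v h0 h₁), hneg⟩
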